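/- Let A be an abelian group and Γ, Δ two sets of endogenies of A, each closed under sum and composition, such that every γ ∈ Γ sharply commutes with every δ ∈ Δ. Let A₀ ≤ A be a subgroup containing the global bikatakernel Kat(Γ,Δ) := Kat(Γ) + Kat(Δ) and satisfying δ[A₀] ⊆ A₀ + kat(δ) for every δ ∈ Δ. Then for every γ ∈ Γ the subgroup γ⁻¹(A₀) := {a ∈ A : γ[a] ⊆ A₀} is weakly Δ-invariant. -/

import Mathlib

open Pointwise

variable {A : Type*} [AddCommGroup A]

/-- `φ` is (the underlying set of) an additive subgroup of `A × A`. -/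
def IsSubgroupRel (φ : Set (A × A)) : Prop :=
  (0 : A × A) ∈ φ ∧ (∀ x ∈ φ, ∀ y ∈ φ, x + y ∈ φ) ∧ ∀ x ∈ φ, -x ∈ φ

/-- The katakernel `kat φ = {b : (0, b) ∈ φ}`. -/
def kat (φ : Set (A × A)) : Set A := {b | ((0 : A), b) ∈ φ}

/-- The image `φ[S] = {b : ∃ a ∈ S, (a, b) ∈ φ}`. -/
def img (φ : Set (A × A)) (S : Set A) : Set A := {b | ∃ a ∈ S, (a, b) ∈ φ}

/-- An endogeny of `A`: a total additive subgroup of `A × A` with finite katakernel. -/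
def IsEndogeny (φ : Set (A × A)) : Prop :=
  IsSubgroupRel φ ∧ (∀ a : A, ∃ b, (a, b) ∈ φ) ∧ (kat φ).Finite

/-- The sum `φ + ψ` of two endogenies. -/
def esum (φ ψ : Set (A × A)) : Set (A × A) :=
  {p | ∃ b₁ b₂, (p.1, b₁) ∈ φ ∧ (p.1, b₂) ∈ ψ ∧ p.2 = b₁ + b₂}

/-- The composition `φ ∘ ψ` of two endogenies. -/
def ecomp (φ ψ : Set (A × A)) : Set (A × A) :=
  {p | ∃ b, (p.1, b) ∈ ψ ∧ (b, p.2) ∈ φ}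

/-- The negation `-φ` of an endogeny. -/
def eneg (φ : Set (A × A)) : Set (A × A) := {p | (p.1, -p.2) ∈ φ}

/-- `φ` and `ψ` sharply commute if `(φ ∘ ψ - ψ ∘ φ)[A] ⊆ kat φ + kat ψ`. -/
def SharpCommute (φ ψ : Set (A × A)) : Prop :=
  img (esum (ecomp φ ψ) (eneg (ecomp ψ φ))) Set.univ ⊆ kat φ + kat ψ

/-- The global katakernel `Kat(Γ)`: the subgroup generated by all katakernels of elements of `Γ`. -/
def KatG (Γ : Set (Set (A × A))) : AddSubgroup A :=
  AddSubgroup.closure (⋃ γ ∈ Γ, kat γ)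

theorem kat_subset_of_KatG_le {Γ : Set (Set (A × A))} {γ : Set (A × A)} (hγ : γ ∈ Γ)
    {B : AddSubgroup A} (hB : KatG Γ ≤ B) : kat γ ⊆ (B : Set A) :=
  fun _ hx => hB (AddSubgroup.subset_closure (Set.mem_biUnion hγ hx))

theorem SharpCommute.sub_mem {φ ψ : Set (A × A)} (h : SharpCommute φ ψ) {a c e : A}
    (hc : (a, c) ∈ ecomp φ ψ) (he : (a, e) ∈ ecomp ψ φ) : c - e ∈ kat φ + kat ψ :=
  h ⟨a, Set.mem_univ a, c, -e, hc, by simpa [eneg] using he, sub_eq_add_neg c e⟩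

theorem preimage_weakly_invariant (Γ Δ : Set (Set (A × A)))
    (hΓ : ∀ γ ∈ Γ, IsEndogeny γ) (hΔ : ∀ δ ∈ Δ, IsEndogeny δ)
    (hΓc : ∀ γ ∈ Γ, ∀ γ' ∈ Γ, esum γ γ' ∈ Γ ∧ ecomp γ γ' ∈ Γ)
    (hΔc : ∀ δ ∈ Δ, ∀ δ' ∈ Δ, esum δ δ' ∈ Δ ∧ ecomp δ δ' ∈ Δ)
    (hc : ∀ γ ∈ Γ, ∀ δ ∈ Δ, SharpCommute γ δ)
    (A₀ : AddSubgroup A) (hA₀ : KatG Γ ⊔ KatG Δ ≤ A₀)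
    (hinv : ∀ δ ∈ Δ, img δ (A₀ : Set A) ⊆ (A₀ : Set A) + kat δ) :
    ∀ γ ∈ Γ, ∀ δ ∈ Δ,
      img δ {a : A | img γ {a} ⊆ (A₀ : Set A)} ⊆
        {a : A | img γ {a} ⊆ (A₀ : Set A)} + kat δ := by
  rintro γ hγ δ hδ b ⟨a, ha, hab⟩
  have hkγ : kat γ ⊆ (A₀ : Set A) := kat_subset_of_KatG_le hγ (le_sup_left.trans hA₀)
  have hkδ : kat δ ⊆ (A₀ : Set A) := kat_subset_of_KatG_le hδ (le_sup_right.trans hA₀)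
  refine ⟨b, ?_, 0, (hΔ δ hδ).1.1, add_zero b⟩
  rintro c ⟨_, rfl, hbc⟩
  obtain ⟨d, had⟩ := (hΓ γ hγ).2.1 a
  obtain ⟨e, hde⟩ := (hΔ δ hδ).2.1 d
  have hd : d ∈ A₀ := ha ⟨a, rfl, had⟩
  have he : e ∈ A₀ := by
    obtain ⟨x, hx, y, hy, rfl⟩ := hinv δ hδ ⟨d, hd, hde⟩
    exact add_mem hx (hkδ hy)
  have hce : c - e ∈ A₀ := by
    obtain ⟨x, hx, y, hy, hxy⟩ := (hc γ hγ δ hδ).sub_mem ⟨_, hab, hbc⟩ ⟨d, had, hde⟩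
    exact hxy ▸ add_mem (hkγ hx) (hkδ hy)
  exact (sub_add_cancel c e) ▸ add_mem hce he
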